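/- (First-and-a-half Korn inequality) There exists a constant C₀(L) depending only on L such that: for any h ∈ (0,1), L > 0, and any φ = (u,v) ∈ H¹(I_h × [0,L]; ℝ²) with v(x,0) = 0 in the sense of traces, ‖∇φ‖² ≤ C₀(L) ‖e(φ)‖ ( ‖u‖/h + ‖e(φ)‖ ), where e(φ) = (∇φ + ∇φᵀ)/2. -/

import Mathlib

open Real MeasureTheory

noncomputable section

/-- x-partial derivative of a function on ℝ². -/
def dx (f : ℝ × ℝ → ℝ) (q : ℝ × ℝ) : ℝ := fderiv ℝ f q (1, 0)

/-- y-partial derivative of a function on ℝ². -/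
def dy (f : ℝ × ℝ → ℝ) (q : ℝ × ℝ) : ℝ := fderiv ℝ f q (0, 1)

/-- The interval I_h = [1-h/2, 1+h/2]. -/
def Ih (h : ℝ) : Set ℝ := Set.Icc (1 - h/2) (1 + h/2)

/-- The rectangle I_h × [0,p]. -/
def rect (h p : ℝ) : Set (ℝ × ℝ) := Ih h ×ˢ Set.Icc 0 p


/-- The closed box `[a, b] × [c, d]`. -/
def box (a b c d : ℝ) : Set (ℝ × ℝ) := Set.Icc a b ×ˢ Set.Icc c d

theorem integrableOn_box {f : ℝ × ℝ → ℝ} (hf : Continuous f) (a b c d : ℝ) :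
    IntegrableOn f (box a b c d) :=
  hf.continuousOn.integrableOn_compact (isCompact_Icc.prod isCompact_Icc)

theorem measurableSet_box (a b c d : ℝ) : MeasurableSet (box a b c d) :=
  measurableSet_Icc.prod measurableSet_Icc

theorem setIntegral_box_eq {f : ℝ × ℝ → ℝ} (hf : Continuous f) (a b c d : ℝ) :
    ∫ q in box a b c d, f q = ∫ x in Set.Icc a b, ∫ y in Set.Icc c d, f (x, y) := by
  have := integrableOn_box hf a b c d
  rw [box, Measure.volume_eq_prod] at *
  exact setIntegral_prod f this

theorem setIntegral_box_swap {f : ℝ × ℝ → ℝ} (a b c d : ℝ) :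
    ∫ q in box a b c d, f q = ∫ q in box c d a b, f q.swap := by
  rw [box, box, Measure.volume_eq_prod]
  exact (setIntegral_prod_swap (Set.Icc a b) (Set.Icc c d) f).symm

theorem setIntegral_box_half_snd_le {f : ℝ × ℝ → ℝ} (hf : Continuous f) (h0 : ∀ q, 0 ≤ f q)
    {a b c d y₁ : ℝ} (hy : y₁ ∈ Set.Icc c d) :
    ∫ q in box a b c d, f (q.1, (q.2 + y₁) / 2) ≤ 2 * ∫ q in box a b c d, f q := by
  have hcd : c ≤ d := hy.1.trans hy.2
  have hg : Continuous fun q : ℝ × ℝ => f (q.1, (q.2 + y₁) / 2) := by fun_prop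
  have i1 := integrableOn_box hf a b c d
  have i2 := integrableOn_box hg a b c d
  rw [setIntegral_box_eq hf, setIntegral_box_eq hg, ← integral_const_mul]
  rw [box, IntegrableOn, Measure.volume_eq_prod, ← Measure.prod_restrict] at i1 i2
  refine integral_mono i2.integral_prod_left (i1.integral_prod_left.const_mul 2) fun x => ?_
  have hx : Continuous fun y => f (x, y) := by fun_prop
  simp only [integral_Icc_eq_integral_Ioc, ← intervalIntegral.integral_of_le hcd]
  have e : ∀ y, f (x, (y + y₁) / 2) = (fun z => f (x, z)) (y / 2 + y₁ / 2) := fun y => by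
    simp only [add_div]
  simp only [e]
  rw [intervalIntegral.integral_comp_div_add (fun z => f (x, z)) two_ne_zero, smul_eq_mul]
  gcongr
  refine intervalIntegral.integral_mono_interval (by linarith [hy.1]) (by linarith)
    (by linarith [hy.2]) (Filter.Eventually.of_forall fun z => h0 _) (hx.intervalIntegrable _ _)

theorem setIntegral_box_half_fst_le {f : ℝ × ℝ → ℝ} (hf : Continuous f) (h0 : ∀ q, 0 ≤ f q)
    {a b c d x₁ : ℝ} (hx : x₁ ∈ Set.Icc a b) :
    ∫ q in box a b c d, f ((q.1 + x₁) / 2, q.2) ≤ 2 * ∫ q in box a b c d, f q := by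
  rw [setIntegral_box_swap, setIntegral_box_swap (f := f)]
  exact setIntegral_box_half_snd_le (f := fun q => f q.swap) (by fun_prop) (fun q => h0 _) hx

/-- The `L²` norm of a function on a set. -/
def l2 (s : Set (ℝ × ℝ)) (f : ℝ × ℝ → ℝ) : ℝ := √(∫ q in s, f q ^ 2)

theorem l2_nonneg (s : Set (ℝ × ℝ)) (f : ℝ × ℝ → ℝ) : 0 ≤ l2 s f := Real.sqrt_nonneg _

theorem l2_sq (s : Set (ℝ × ℝ)) (f : ℝ × ℝ → ℝ) : l2 s f ^ 2 = ∫ q in s, f q ^ 2 :=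
  Real.sq_sqrt (integral_nonneg fun _ => sq_nonneg _)

theorem setIntegral_mul_le_l2 {f g : ℝ × ℝ → ℝ} (hf : Continuous f) (hg : Continuous g)
    (a b c d : ℝ) :
    ∫ q in box a b c d, f q * g q ≤ l2 (box a b c d) f * l2 (box a b c d) g := by
  have key : ∀ t : ℝ, 0 ≤ (∫ q in box a b c d, f q ^ 2) * (t * t)
      + (2 * ∫ q in box a b c d, f q * g q) * t + ∫ q in box a b c d, g q ^ 2 := fun t => by
    have e : ∫ q in box a b c d, (t * f q + g q) ^ 2
        = (∫ q in box a b c d, f q ^ 2) * (t * t)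
      + (2 * ∫ q in box a b c d, f q * g q) * t + ∫ q in box a b c d, g q ^ 2 := by
      rw [← integral_mul_const, ← integral_const_mul, ← integral_mul_const, ← integral_add,
        ← integral_add]
      · exact integral_congr_ae (Filter.Eventually.of_forall fun q => by ring)
      all_goals exact integrableOn_box (by fun_prop) a b c d
    rw [← e]
    exact integral_nonneg fun _ => sq_nonneg _
  have hd := discrim_le_zero key
  rw [discrim, ← l2_sq, ← l2_sq] at hd
  refine (le_abs_self _).trans
    (abs_le_of_sq_le_sq ?_ (mul_nonneg (l2_nonneg _ _) (l2_nonneg _ _)))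
  nlinarith

theorem l2_abs (s : Set (ℝ × ℝ)) (f : ℝ × ℝ → ℝ) : l2 s (fun q => |f q|) = l2 s f := by
  simp [l2]

theorem abs_setIntegral_weight_mul_le {f g w : ℝ × ℝ → ℝ} (hf : Continuous f) (hg : Continuous g)
    (hw : Continuous w) {a b c d M : ℝ} (hM : ∀ q ∈ box a b c d, |w q| ≤ M) (hM0 : 0 ≤ M) :
    |∫ q in box a b c d, w q * (f q * g q)| ≤ M * (l2 (box a b c d) f * l2 (box a b c d) g) := by
  calc |∫ q in box a b c d, w q * (f q * g q)|
      ≤ ∫ q in box a b c d, |w q * (f q * g q)| := abs_integral_le_integral_abs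
    _ ≤ ∫ q in box a b c d, M * (|f q| * |g q|) := by
        refine setIntegral_mono_on (integrableOn_box (by fun_prop) a b c d)
          (integrableOn_box (by fun_prop) a b c d) (measurableSet_box a b c d) fun q hq => ?_
        rw [abs_mul, abs_mul]
        exact mul_le_mul_of_nonneg_right (hM q hq) (by positivity)
    _ ≤ _ := by
        rw [integral_const_mul]
        refine mul_le_mul_of_nonneg_left ?_ hM0
        rw [← l2_abs _ f, ← l2_abs _ g]
        exact setIntegral_mul_le_l2 hf.abs hg.abs a b c d

theorem l2_add_le {f g : ℝ × ℝ → ℝ} (hf : Continuous f) (hg : Continuous g) (a b c d : ℝ) :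
    l2 (box a b c d) (fun q => f q + g q) ≤ l2 (box a b c d) f + l2 (box a b c d) g := by
  refine Real.sqrt_le_iff.2 ⟨add_nonneg (l2_nonneg _ _) (l2_nonneg _ _), ?_⟩
  have e : ∫ q in box a b c d, (f q + g q) ^ 2
      = (∫ q in box a b c d, f q ^ 2) + (2 * ∫ q in box a b c d, f q * g q)
        + ∫ q in box a b c d, g q ^ 2 := by
    rw [← integral_const_mul, ← integral_add, ← integral_add]
    · exact integral_congr_ae (Filter.Eventually.of_forall fun q => by ring)
    all_goals exact integrableOn_box (by fun_prop) a b c d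
  rw [e, ← l2_sq, ← l2_sq]
  nlinarith [setIntegral_mul_le_l2 hf hg a b c d]

theorem l2_const_mul (s : Set (ℝ × ℝ)) (f : ℝ × ℝ → ℝ) (α : ℝ) :
    l2 s (fun q => α * f q) = |α| * l2 s f := by
  simp only [l2, mul_pow, integral_const_mul]
  rw [Real.sqrt_mul (sq_nonneg α), Real.sqrt_sq_eq_abs]

/-- Combination of a function with its dilation by one half towards the line `x = x₁`. -/
def dilX (x₁ α β : ℝ) (f : ℝ × ℝ → ℝ) (q : ℝ × ℝ) : ℝ := α * f q + β * f ((q.1 + x₁) / 2, q.2)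

/-- Combination of a function with its dilation by one half towards the line `y = y₁`. -/
def dilY (y₁ α β : ℝ) (f : ℝ × ℝ → ℝ) (q : ℝ × ℝ) : ℝ := α * f q + β * f (q.1, (q.2 + y₁) / 2)

theorem ContDiff.dilX {n : WithTop ℕ∞} {f : ℝ × ℝ → ℝ} (hf : ContDiff ℝ n f) (x₁ α β : ℝ) :
    ContDiff ℝ n (dilX x₁ α β f) := by
  unfold _root_.dilX
  exact (contDiff_const.mul hf).add (contDiff_const.mul (hf.comp (by fun_prop)))

theorem ContDiff.dilY {n : WithTop ℕ∞} {f : ℝ × ℝ → ℝ} (hf : ContDiff ℝ n f) (y₁ α β : ℝ) :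
    ContDiff ℝ n (dilY y₁ α β f) := by
  unfold _root_.dilY
  exact (contDiff_const.mul hf).add (contDiff_const.mul (hf.comp (by fun_prop)))

theorem l2_add_mul_le {f g : ℝ × ℝ → ℝ} (hf : Continuous f) (hg : Continuous g) {a b c d : ℝ}
    (α β : ℝ) (h : ∫ q in box a b c d, g q ^ 2 ≤ 2 * ∫ q in box a b c d, f q ^ 2) :
    l2 (box a b c d) (fun q => α * f q + β * g q) ≤ (|α| + 2 * |β|) * l2 (box a b c d) f := by
  have hg2 : l2 (box a b c d) g ≤ 2 * l2 (box a b c d) f := by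
    refine Real.sqrt_le_iff.2 ⟨by linarith [l2_nonneg (box a b c d) f], ?_⟩
    nlinarith [l2_sq (box a b c d) f, l2_nonneg (box a b c d) f]
  have := l2_add_le (f := fun q => α * f q) (g := fun q => β * g q) (by fun_prop) (by fun_prop)
    a b c d
  rw [l2_const_mul, l2_const_mul] at this
  nlinarith [mul_le_mul_of_nonneg_left hg2 (abs_nonneg β)]

theorem l2_dilX_le {f : ℝ × ℝ → ℝ} (hf : Continuous f) {a b c d x₁ : ℝ} (hx : x₁ ∈ Set.Icc a b)
    (α β : ℝ) :
    l2 (box a b c d) (dilX x₁ α β f) ≤ (|α| + 2 * |β|) * l2 (box a b c d) f :=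
  l2_add_mul_le (g := fun q => f ((q.1 + x₁) / 2, q.2)) hf (by fun_prop) α β
    (setIntegral_box_half_fst_le (f := fun q => f q ^ 2) (by fun_prop) (fun _ => sq_nonneg _) hx)

theorem l2_dilY_le {f : ℝ × ℝ → ℝ} (hf : Continuous f) {a b c d y₁ : ℝ} (hy : y₁ ∈ Set.Icc c d)
    (α β : ℝ) :
    l2 (box a b c d) (dilY y₁ α β f) ≤ (|α| + 2 * |β|) * l2 (box a b c d) f :=
  l2_add_mul_le (g := fun q => f (q.1, (q.2 + y₁) / 2)) hf (by fun_prop) α β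
    (setIntegral_box_half_snd_le (f := fun q => f q ^ 2) (by fun_prop) (fun _ => sq_nonneg _) hy)

theorem ContDiff.dx {f : ℝ × ℝ → ℝ} (hf : ContDiff ℝ (⊤ : ℕ∞) f) :
    ContDiff ℝ (⊤ : ℕ∞) (dx f) := by
  unfold _root_.dx
  exact (hf.fderiv_right (m := (⊤ : ℕ∞)) (by simp)).clm_apply contDiff_const

theorem ContDiff.dy {f : ℝ × ℝ → ℝ} (hf : ContDiff ℝ (⊤ : ℕ∞) f) :
    ContDiff ℝ (⊤ : ℕ∞) (dy f) := by
  unfold _root_.dy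
  exact (hf.fderiv_right (m := (⊤ : ℕ∞)) (by simp)).clm_apply contDiff_const

theorem hasDerivAt_fst_line {f : ℝ × ℝ → ℝ} (hf : Differentiable ℝ f) (x y : ℝ) :
    HasDerivAt (fun t => f (t, y)) (dx f (x, y)) x :=
  (hf (x, y)).hasFDerivAt.comp_hasDerivAt x ((hasDerivAt_id x).prodMk (hasDerivAt_const x y))

theorem hasDerivAt_snd_line {f : ℝ × ℝ → ℝ} (hf : Differentiable ℝ f) (x y : ℝ) :
    HasDerivAt (fun t => f (x, t)) (dy f (x, y)) y :=
  (hf (x, y)).hasFDerivAt.comp_hasDerivAt y ((hasDerivAt_const y x).prodMk (hasDerivAt_id y))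

theorem dx_dilX {f : ℝ × ℝ → ℝ} (hf : ContDiff ℝ (⊤ : ℕ∞) f) (x₁ α β : ℝ) :
    dx (dilX x₁ α β f) = dilX x₁ α (β / 2) (dx f) := by
  have hd := hf.differentiable (by simp)
  ext ⟨x, y⟩
  refine (hasDerivAt_fst_line ((hf.dilX x₁ α β).differentiable (by simp)) x y).unique ?_
  have h2 := (hasDerivAt_fst_line hd ((x + x₁) / 2) y).scomp x
    (((hasDerivAt_id x).add_const x₁).div_const 2)
  refine (((hasDerivAt_fst_line hd x y).const_mul α).add (h2.const_mul β)).congr_deriv ?_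
  simp only [dilX, smul_eq_mul]
  ring

theorem dy_dilX {f : ℝ × ℝ → ℝ} (hf : ContDiff ℝ (⊤ : ℕ∞) f) (x₁ α β : ℝ) :
    dy (dilX x₁ α β f) = dilX x₁ α β (dy f) := by
  have hd := hf.differentiable (by simp)
  ext ⟨x, y⟩
  refine (hasDerivAt_snd_line ((hf.dilX x₁ α β).differentiable (by simp)) x y).unique ?_
  exact ((hasDerivAt_snd_line hd x y).const_mul α).add
    ((hasDerivAt_snd_line hd ((x + x₁) / 2) y).const_mul β)

theorem dy_dilY {f : ℝ × ℝ → ℝ} (hf : ContDiff ℝ (⊤ : ℕ∞) f) (y₁ α β : ℝ) :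
    dy (dilY y₁ α β f) = dilY y₁ α (β / 2) (dy f) := by
  have hd := hf.differentiable (by simp)
  ext ⟨x, y⟩
  refine (hasDerivAt_snd_line ((hf.dilY y₁ α β).differentiable (by simp)) x y).unique ?_
  have h2 := (hasDerivAt_snd_line hd x ((y + y₁) / 2)).scomp y
    (((hasDerivAt_id y).add_const y₁).div_const 2)
  refine (((hasDerivAt_snd_line hd x y).const_mul α).add (h2.const_mul β)).congr_deriv ?_
  simp only [dilY, smul_eq_mul]
  ring

theorem dx_dilY {f : ℝ × ℝ → ℝ} (hf : ContDiff ℝ (⊤ : ℕ∞) f) (y₁ α β : ℝ) :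
    dx (dilY y₁ α β f) = dilY y₁ α β (dx f) := by
  have hd := hf.differentiable (by simp)
  ext ⟨x, y⟩
  refine (hasDerivAt_fst_line ((hf.dilY y₁ α β).differentiable (by simp)) x y).unique ?_
  exact ((hasDerivAt_fst_line hd x y).const_mul α).add
    ((hasDerivAt_fst_line hd x ((y + y₁) / 2)).const_mul β)

theorem dx_dy_comm {f : ℝ × ℝ → ℝ} (hf : ContDiff ℝ (⊤ : ℕ∞) f) (q : ℝ × ℝ) :
    dx (dy f) q = dy (dx f) q := by
  have hs : IsSymmSndFDerivAt ℝ f q :=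
    hf.contDiffAt.isSymmSndFDerivAt (by simpa using WithTop.coe_le_coe.2 (le_top : (2 : ℕ∞) ≤ ⊤))
  have hd : DifferentiableAt ℝ (fderiv ℝ f) q :=
    ((hf.fderiv_right (m := (⊤ : ℕ∞)) (by simp)).differentiable (by simp)) q
  unfold dx dy
  rw [fderiv_clm_apply hd (differentiableAt_const _), fderiv_clm_apply hd (differentiableAt_const _)]
  simpa using hs (1, 0) (0, 1)

theorem setIntegral_dy_eq {F G : ℝ × ℝ → ℝ} (hF : ContDiff ℝ (⊤ : ℕ∞) F)
    (hG : ContDiff ℝ (⊤ : ℕ∞) G) {a b c d : ℝ} (hcd : c ≤ d)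
    (hc : ∀ x ∈ Set.Icc a b, F (x, c) = G (x, c)) (hd : ∀ x ∈ Set.Icc a b, F (x, d) = G (x, d)) :
    ∫ q in box a b c d, dy F q = ∫ q in box a b c d, dy G q := by
  have ftc : ∀ {H : ℝ × ℝ → ℝ}, ContDiff ℝ (⊤ : ℕ∞) H → ∀ x,
      ∫ y in Set.Icc c d, dy H (x, y) = H (x, d) - H (x, c) := fun {H} hH x => by
    have := hH.dy.continuous
    rw [integral_Icc_eq_integral_Ioc, ← intervalIntegral.integral_of_le hcd]
    exact intervalIntegral.integral_eq_sub_of_hasDerivAt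
      (fun y _ => hasDerivAt_snd_line (hH.differentiable (by simp)) x y)
      (Continuous.intervalIntegrable (by fun_prop) _ _)
  rw [setIntegral_box_eq hF.dy.continuous, setIntegral_box_eq hG.dy.continuous]
  refine setIntegral_congr_fun measurableSet_Icc fun x hx => ?_
  simp only [ftc hF, ftc hG, hc x hx, hd x hx]

theorem setIntegral_dx_eq {F G : ℝ × ℝ → ℝ} (hF : ContDiff ℝ (⊤ : ℕ∞) F)
    (hG : ContDiff ℝ (⊤ : ℕ∞) G) {a b c d : ℝ} (hab : a ≤ b)
    (ha : ∀ y ∈ Set.Icc c d, F (a, y) = G (a, y)) (hb : ∀ y ∈ Set.Icc c d, F (b, y) = G (b, y)) :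
    ∫ q in box a b c d, dx F q = ∫ q in box a b c d, dx G q := by
  have sw : ∀ {H : ℝ × ℝ → ℝ}, ContDiff ℝ (⊤ : ℕ∞) H → ∀ q : ℝ × ℝ,
      dx H q.swap = dy (fun p => H p.swap) q := fun {H} hH q => by
    have h2 : ContDiff ℝ (⊤ : ℕ∞) fun p : ℝ × ℝ => H p.swap :=
      hH.comp (contDiff_snd.prodMk contDiff_fst)
    exact (hasDerivAt_fst_line (hH.differentiable (by simp)) q.2 q.1).unique
      (hasDerivAt_snd_line (h2.differentiable (by simp)) q.1 q.2)
  rw [setIntegral_box_swap, setIntegral_box_swap (f := dx G)]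
  simp only [sw hF, sw hG]
  exact setIntegral_dy_eq (hF.comp (contDiff_snd.prodMk contDiff_fst))
    (hG.comp (contDiff_snd.prodMk contDiff_fst)) hab ha hb

theorem l2_le_of_eq_zero_bottom {v : ℝ × ℝ → ℝ} (hv : ContDiff ℝ (⊤ : ℕ∞) v) {a b L : ℝ}
    (hL : 0 ≤ L) (h0 : ∀ x ∈ Set.Icc a b, v (x, 0) = 0) :
    l2 (box a b 0 L) v ≤ 2 * L * l2 (box a b 0 L) (dy v) := by
  have hvc := hv.continuous
  have hdc := hv.dy.continuous
  have hF : ContDiff ℝ (⊤ : ℕ∞) fun q : ℝ × ℝ => (q.2 - L) * v q ^ 2 := by fun_prop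
  have e : ∀ q : ℝ × ℝ, dy (fun q : ℝ × ℝ => (q.2 - L) * v q ^ 2) q
      = v q ^ 2 + (2 * (q.2 - L)) * (v q * dy v q) := fun ⟨x, y⟩ => by
    refine (hasDerivAt_snd_line (hF.differentiable (by simp)) x y).unique ?_
    have h1 := hasDerivAt_snd_line (hv.differentiable (by simp)) x y
    refine (((hasDerivAt_id y).sub_const L).mul (h1.pow 2)).congr_deriv ?_
    simp only [id, Pi.pow_apply]
    ring
  have hz := setIntegral_dy_eq hF (contDiff_const (c := (0 : ℝ))) (a := a) (b := b) hL
    (fun x hx => by simp [h0 x hx]) (fun x _ => by simp)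
  have hz0 : ∫ q in box a b 0 L, dy (fun _ : ℝ × ℝ => (0 : ℝ)) q = 0 := by simp [dy]
  rw [hz0] at hz
  simp only [e] at hz
  rw [integral_add (integrableOn_box (by fun_prop) _ _ _ _)
    (integrableOn_box (by fun_prop) _ _ _ _), ← l2_sq] at hz
  have hb := (abs_le.1 (abs_setIntegral_weight_mul_le hvc hdc
    (w := fun q : ℝ × ℝ => 2 * (q.2 - L)) (by fun_prop) (a := a) (b := b) (c := 0) (d := L)
    (M := 2 * L) (fun q hq => by
      rw [abs_le]; constructor <;> linarith [hq.2.1, hq.2.2]) (by positivity))).1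
  rcases (l2_nonneg (box a b 0 L) v).eq_or_lt with h | h
  · rw [← h]
    have := l2_nonneg (box a b 0 L) (dy v)
    positivity
  · nlinarith

/-- The product weight equal to one at the corner `(x₁, y₁)` and vanishing on `x = x₂`, `y = y₂`. -/
def cut (x₁ x₂ y₁ y₂ : ℝ) (q : ℝ × ℝ) : ℝ :=
  (x₂ - q.1) / (x₂ - x₁) * ((y₂ - q.2) / (y₂ - y₁))

/-- The first component of the flux of the weighted Jacobian. -/
def fluxX (x₁ x₂ y₁ y₂ : ℝ) (P Q : ℝ × ℝ → ℝ) (q : ℝ × ℝ) : ℝ :=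
  (x₂ - q.1) / (x₂ - x₁) * (P q * (Q q / (y₂ - y₁) - (y₂ - q.2) / (y₂ - y₁) * dy Q q))

/-- The second component of the flux of the weighted Jacobian. -/
def fluxY (x₁ x₂ y₁ y₂ : ℝ) (P Q : ℝ × ℝ → ℝ) (q : ℝ × ℝ) : ℝ :=
  cut x₁ x₂ y₁ y₂ q * (P q * dx Q q)

/-- The part of the weighted Jacobian that does not involve off-diagonal derivatives. -/
def lower (x₁ x₂ y₁ y₂ : ℝ) (P Q : ℝ × ℝ → ℝ) (q : ℝ × ℝ) : ℝ :=
  cut x₁ x₂ y₁ y₂ q * (dx P q * dy Q q)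
    + -((y₂ - q.2) / (y₂ - y₁) / (x₂ - x₁)) * (P q * dy Q q)
    + 1 / (x₂ - x₁) / (y₂ - y₁) * (P q * Q q)
    + -((x₂ - q.1) / (x₂ - x₁) / (y₂ - y₁)) * (dx P q * Q q)

section Corner

variable {x₁ x₂ y₁ y₂ : ℝ} {P Q : ℝ × ℝ → ℝ}

theorem continuous_cut (x₁ x₂ y₁ y₂ : ℝ) : Continuous (cut x₁ x₂ y₁ y₂) := by
  unfold cut; fun_prop

theorem contDiff_fluxX (hP : ContDiff ℝ (⊤ : ℕ∞) P) (hQ : ContDiff ℝ (⊤ : ℕ∞) Q) :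
    ContDiff ℝ (⊤ : ℕ∞) (fluxX x₁ x₂ y₁ y₂ P Q) := by
  have := hQ.dy
  unfold fluxX; fun_prop

theorem contDiff_fluxY (hP : ContDiff ℝ (⊤ : ℕ∞) P) (hQ : ContDiff ℝ (⊤ : ℕ∞) Q) :
    ContDiff ℝ (⊤ : ℕ∞) (fluxY x₁ x₂ y₁ y₂ P Q) := by
  have := hQ.dx
  unfold fluxY cut; fun_prop

theorem continuous_lower (hP : ContDiff ℝ (⊤ : ℕ∞) P) (hQ : ContDiff ℝ (⊤ : ℕ∞) Q) :
    Continuous (lower x₁ x₂ y₁ y₂ P Q) := by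
  have := hP.continuous
  have := hQ.continuous
  have := hP.dx.continuous
  have := hQ.dy.continuous
  unfold lower cut; fun_prop

theorem cut_mul_dy_mul_dx (hP : ContDiff ℝ (⊤ : ℕ∞) P) (hQ : ContDiff ℝ (⊤ : ℕ∞) Q)
    (q : ℝ × ℝ) :
    cut x₁ x₂ y₁ y₂ q * (dy P q * dx Q q) = dy (fluxY x₁ x₂ y₁ y₂ P Q) q
      + dx (fluxX x₁ x₂ y₁ y₂ P Q) q + lower x₁ x₂ y₁ y₂ P Q q := by
  obtain ⟨x, y⟩ := q
  have hPd := hP.differentiable (by simp)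
  have hQd := hQ.differentiable (by simp)
  have e1 : dy (fluxY x₁ x₂ y₁ y₂ P Q) (x, y) =
      (x₂ - x) / (x₂ - x₁) * (-1 / (y₂ - y₁)) * (P (x, y) * dx Q (x, y))
      + cut x₁ x₂ y₁ y₂ (x, y) * (dy P (x, y) * dx Q (x, y) + P (x, y) * dy (dx Q) (x, y)) := by
    refine (hasDerivAt_snd_line ((contDiff_fluxY hP hQ).differentiable (by simp)) x y).unique ?_
    have hw := ((((hasDerivAt_id y).const_sub y₂).div_const (y₂ - y₁)).const_mul
      ((x₂ - x) / (x₂ - x₁)))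
    exact hw.mul ((hasDerivAt_snd_line hPd x y).mul
      (hasDerivAt_snd_line (hQ.dx.differentiable (by simp)) x y))
  have e2 : dx (fluxX x₁ x₂ y₁ y₂ P Q) (x, y) =
      -1 / (x₂ - x₁)
        * (P (x, y) * (Q (x, y) / (y₂ - y₁) - (y₂ - y) / (y₂ - y₁) * dy Q (x, y)))
      + (x₂ - x) / (x₂ - x₁)
        * (dx P (x, y) * (Q (x, y) / (y₂ - y₁) - (y₂ - y) / (y₂ - y₁) * dy Q (x, y))
          + P (x, y) * (dx Q (x, y) / (y₂ - y₁) - (y₂ - y) / (y₂ - y₁) * dx (dy Q) (x, y))) := by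
    refine (hasDerivAt_fst_line ((contDiff_fluxX hP hQ).differentiable (by simp)) x y).unique ?_
    have hw := ((hasDerivAt_id x).const_sub x₂).div_const (x₂ - x₁)
    exact hw.mul ((hasDerivAt_fst_line hPd x y).mul
      (((hasDerivAt_fst_line hQd x y).div_const _).sub
        ((hasDerivAt_fst_line (hQ.dy.differentiable (by simp)) x y).const_mul
          ((y₂ - y) / (y₂ - y₁)))))
  rw [e1, e2, dx_dy_comm hQ]
  unfold lower cut
  ring

theorem setIntegral_cut_mul_dy_mul_dx (hP : ContDiff ℝ (⊤ : ℕ∞) P) (hQ : ContDiff ℝ (⊤ : ℕ∞) Q)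
    (a b c d : ℝ) :
    ∫ q in box a b c d, cut x₁ x₂ y₁ y₂ q * (dy P q * dx Q q)
      = (∫ q in box a b c d, dy (fluxY x₁ x₂ y₁ y₂ P Q) q)
      + (∫ q in box a b c d, dx (fluxX x₁ x₂ y₁ y₂ P Q) q)
      + ∫ q in box a b c d, lower x₁ x₂ y₁ y₂ P Q q := by
  have i1 := integrableOn_box (contDiff_fluxY (x₁ := x₁) (x₂ := x₂) (y₁ := y₁) (y₂ := y₂)
    hP hQ).dy.continuous a b c d
  have i2 := integrableOn_box (contDiff_fluxX (x₁ := x₁) (x₂ := x₂) (y₁ := y₁) (y₂ := y₂)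
    hP hQ).dx.continuous a b c d
  have i3 := integrableOn_box (continuous_lower (x₁ := x₁) (x₂ := x₂) (y₁ := y₁) (y₂ := y₂)
    hP hQ) a b c d
  simp only [cut_mul_dy_mul_dx hP hQ]
  rw [integral_add, integral_add i1 i2]
  exacts [i1.add i2, i3]

variable {a b c d : ℝ}

/-- `x₁` and `x₂` are the two endpoints of `[a, b]`, in some order. -/
def AreEndpoints (a b x₁ x₂ : ℝ) : Prop := (x₁ = a ∧ x₂ = b) ∨ (x₁ = b ∧ x₂ = a)

theorem AreEndpoints.mem (hab : a < b) (h : AreEndpoints a b x₁ x₂) : x₁ ∈ Set.Icc a b := by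
  rcases h with ⟨rfl, rfl⟩ | ⟨rfl, rfl⟩ <;> simp [hab.le]

theorem AreEndpoints.abs_sub (hab : a < b) (h : AreEndpoints a b x₁ x₂) :
    |x₂ - x₁| = b - a := by
  rcases h with ⟨rfl, rfl⟩ | ⟨rfl, rfl⟩
  · exact abs_of_pos (by linarith)
  · rw [abs_sub_comm]; exact abs_of_pos (by linarith)

theorem AreEndpoints.weight_mem (hab : a < b) (h : AreEndpoints a b x₁ x₂) {x : ℝ}
    (hx : x ∈ Set.Icc a b) : 0 ≤ (x₂ - x) / (x₂ - x₁) ∧ (x₂ - x) / (x₂ - x₁) ≤ 1 := by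
  rcases h with ⟨rfl, rfl⟩ | ⟨rfl, rfl⟩
  · exact ⟨div_nonneg (by linarith [hx.2]) (by linarith),
      (div_le_one (by linarith)).2 (by linarith [hx.1])⟩
  · exact ⟨div_nonneg_of_nonpos (by linarith [hx.1]) (by linarith),
      (div_le_one_of_neg (by linarith)).2 (by linarith [hx.2])⟩

theorem cut_nonneg (hab : a < b) (hcd : c < d) (hx : AreEndpoints a b x₁ x₂)
    (hy : AreEndpoints c d y₁ y₂) {q : ℝ × ℝ} (hq : q ∈ box a b c d) :
    0 ≤ cut x₁ x₂ y₁ y₂ q :=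
  mul_nonneg (hx.weight_mem hab hq.1).1 (hy.weight_mem hcd hq.2).1

theorem abs_cut_le (hab : a < b) (hcd : c < d) (hx : AreEndpoints a b x₁ x₂)
    (hy : AreEndpoints c d y₁ y₂) {q : ℝ × ℝ} (hq : q ∈ box a b c d) :
    |cut x₁ x₂ y₁ y₂ q| ≤ 1 := by
  rw [abs_of_nonneg (cut_nonneg hab hcd hx hy hq)]
  exact mul_le_one₀ (hx.weight_mem hab hq.1).2 (hy.weight_mem hcd hq.2).1
    (hy.weight_mem hcd hq.2).2

theorem setIntegral_dx_fluxX_eq {P' Q' : ℝ × ℝ → ℝ} (hab : a < b) (hx : AreEndpoints a b x₁ x₂)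
    (hP : ContDiff ℝ (⊤ : ℕ∞) P) (hQ : ContDiff ℝ (⊤ : ℕ∞) Q)
    (hP' : ContDiff ℝ (⊤ : ℕ∞) P') (hQ' : ContDiff ℝ (⊤ : ℕ∞) Q')
    (h1 : ∀ y, P (x₁, y) = P' (x₁, y)) (h2 : ∀ y, Q (x₁, y) = Q' (x₁, y))
    (h3 : ∀ y, dy Q (x₁, y) = dy Q' (x₁, y)) :
    ∫ q in box a b c d, dx (fluxX x₁ x₂ y₁ y₂ P Q) q
      = ∫ q in box a b c d, dx (fluxX x₁ x₂ y₁ y₂ P' Q') q := by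
  have e1 : ∀ y, fluxX x₁ x₂ y₁ y₂ P Q (x₁, y) = fluxX x₁ x₂ y₁ y₂ P' Q' (x₁, y) := fun y => by
    simp [fluxX, h1, h2, h3]
  have e2 : ∀ y, fluxX x₁ x₂ y₁ y₂ P Q (x₂, y) = fluxX x₁ x₂ y₁ y₂ P' Q' (x₂, y) := fun y => by
    simp [fluxX]
  refine setIntegral_dx_eq (contDiff_fluxX hP hQ) (contDiff_fluxX hP' hQ') hab.le
    (fun y _ => ?_) fun y _ => ?_ <;> rcases hx with ⟨rfl, rfl⟩ | ⟨rfl, rfl⟩ <;> simp only [e1, e2]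

theorem setIntegral_dy_fluxY_eq {P' Q' : ℝ × ℝ → ℝ} (hcd : c < d) (hy : AreEndpoints c d y₁ y₂)
    (hP : ContDiff ℝ (⊤ : ℕ∞) P) (hQ : ContDiff ℝ (⊤ : ℕ∞) Q)
    (hP' : ContDiff ℝ (⊤ : ℕ∞) P') (hQ' : ContDiff ℝ (⊤ : ℕ∞) Q')
    (h1 : ∀ x, P (x, y₁) = P' (x, y₁)) (h2 : ∀ x, dx Q (x, y₁) = dx Q' (x, y₁)) :
    ∫ q in box a b c d, dy (fluxY x₁ x₂ y₁ y₂ P Q) q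
      = ∫ q in box a b c d, dy (fluxY x₁ x₂ y₁ y₂ P' Q') q := by
  have e1 : ∀ x, fluxY x₁ x₂ y₁ y₂ P Q (x, y₁) = fluxY x₁ x₂ y₁ y₂ P' Q' (x, y₁) := fun x => by
    simp [fluxY, h1, h2]
  have e2 : ∀ x, fluxY x₁ x₂ y₁ y₂ P Q (x, y₂) = fluxY x₁ x₂ y₁ y₂ P' Q' (x, y₂) := fun x => by
    simp [fluxY, cut]
  refine setIntegral_dy_eq (contDiff_fluxY hP hQ) (contDiff_fluxY hP' hQ') hcd.le
    (fun y _ => ?_) fun y _ => ?_ <;> rcases hy with ⟨rfl, rfl⟩ | ⟨rfl, rfl⟩ <;> simp only [e1, e2]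

theorem abs_setIntegral_lower_le (hab : a < b) (hcd : c < d) (hx : AreEndpoints a b x₁ x₂)
    (hy : AreEndpoints c d y₁ y₂) (hP : ContDiff ℝ (⊤ : ℕ∞) P) (hQ : ContDiff ℝ (⊤ : ℕ∞) Q) :
    |∫ q in box a b c d, lower x₁ x₂ y₁ y₂ P Q q|
      ≤ l2 (box a b c d) (dx P) * l2 (box a b c d) (dy Q)
      + 1 / (b - a) * (l2 (box a b c d) P * l2 (box a b c d) (dy Q))
      + 1 / (b - a) / (d - c) * (l2 (box a b c d) P * l2 (box a b c d) Q)
      + 1 / (d - c) * (l2 (box a b c d) (dx P) * l2 (box a b c d) Q) := by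
  have cP := hP.continuous
  have cQ := hQ.continuous
  have cPx := hP.dx.continuous
  have cQy := hQ.dy.continuous
  have cc := continuous_cut x₁ x₂ y₁ y₂
  have hba : 0 < b - a := sub_pos.2 hab
  have hdc : 0 < d - c := sub_pos.2 hcd
  have t1 := abs_setIntegral_weight_mul_le cPx cQy cc
    (fun q hq => abs_cut_le hab hcd hx hy hq) zero_le_one
  have t2 := abs_setIntegral_weight_mul_le cP cQy
    (w := fun q : ℝ × ℝ => -((y₂ - q.2) / (y₂ - y₁) / (x₂ - x₁))) (by fun_prop)
    (a := a) (b := b) (c := c) (d := d) (M := 1 / (b - a)) (fun q hq => by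
      have := hy.weight_mem hcd hq.2
      rw [abs_neg, abs_div, hx.abs_sub hab, abs_of_nonneg this.1]
      exact div_le_div_of_nonneg_right this.2 hba.le) (by positivity)
  have t3 := abs_setIntegral_weight_mul_le cP cQ
    (w := fun _ : ℝ × ℝ => 1 / (x₂ - x₁) / (y₂ - y₁)) (by fun_prop)
    (a := a) (b := b) (c := c) (d := d) (M := 1 / (b - a) / (d - c)) (fun q hq => by
      rw [abs_div, abs_div, hx.abs_sub hab, hy.abs_sub hcd, abs_one]) (by positivity)
  have t4 := abs_setIntegral_weight_mul_le cPx cQ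
    (w := fun q : ℝ × ℝ => -((x₂ - q.1) / (x₂ - x₁) / (y₂ - y₁))) (by fun_prop)
    (a := a) (b := b) (c := c) (d := d) (M := 1 / (d - c)) (fun q hq => by
      have := hx.weight_mem hab hq.1
      rw [abs_neg, abs_div, hy.abs_sub hcd, abs_of_nonneg this.1]
      exact div_le_div_of_nonneg_right this.2 hdc.le) (by positivity)
  rw [one_mul] at t1
  unfold lower
  rw [integral_add, integral_add, integral_add]
  · refine (abs_add_le _ _).trans (add_le_add ((abs_add_le _ _).trans
      (add_le_add ((abs_add_le _ _).trans (add_le_add t1 t2)) t3)) t4)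
  all_goals exact integrableOn_box (by fun_prop) a b c d

theorem setIntegral_cut_mul_reflections (hab : a < b) (hcd : c < d) (hx : AreEndpoints a b x₁ x₂)
    (hy : AreEndpoints c d y₁ y₂) {u v : ℝ × ℝ → ℝ} (hu : ContDiff ℝ (⊤ : ℕ∞) u)
    (hv : ContDiff ℝ (⊤ : ℕ∞) v) :
    let w := cut x₁ x₂ y₁ y₂
    let Λ := fun P Q => ∫ q in box a b c d, lower x₁ x₂ y₁ y₂ P Q q
    let J := fun P Q => ∫ q in box a b c d, w q * (dy P q * dx Q q)
    let X := dilX x₁ 4 (-3)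
    let X' := dilX x₁ (-2) 3
    let Y := dilY y₁ 4 (-3)
    let Y' := dilY y₁ (-2) 3
    J u v - J (X u) (X' v) - J (Y' u) (Y v) + J (X (Y' u)) (X' (Y v))
      = Λ u v - Λ (X u) (X' v) - Λ (Y' u) (Y v) + Λ (X (Y' u)) (X' (Y v)) := by
  intro w Λ J X X' Y Y'
  have hu2 : ContDiff ℝ (⊤ : ℕ∞) (Y' u) := hu.dilY _ _ _
  have hv2 : ContDiff ℝ (⊤ : ℕ∞) (Y v) := hv.dilY _ _ _
  have hu1 : ContDiff ℝ (⊤ : ℕ∞) (X u) := hu.dilX _ _ _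
  have hv1 : ContDiff ℝ (⊤ : ℕ∞) (X' v) := hv.dilX _ _ _
  have hu3 : ContDiff ℝ (⊤ : ℕ∞) (X (Y' u)) := hu2.dilX _ _ _
  have hv3 : ContDiff ℝ (⊤ : ℕ∞) (X' (Y v)) := hv2.dilX _ _ _
  have hX : ∀ {P Q : ℝ × ℝ → ℝ}, ContDiff ℝ (⊤ : ℕ∞) P → ContDiff ℝ (⊤ : ℕ∞) Q →
      ∫ q in box a b c d, dx (fluxX x₁ x₂ y₁ y₂ P Q) q
        = ∫ q in box a b c d, dx (fluxX x₁ x₂ y₁ y₂ (X P) (X' Q)) q := fun hP hQ => by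
    refine setIntegral_dx_fluxX_eq hab hx hP hQ (hP.dilX _ _ _) (hQ.dilX _ _ _)
      (fun y => ?_) (fun y => ?_) fun y => ?_
    · simp only [X, dilX, add_self_div_two]; ring
    · simp only [X', dilX, add_self_div_two]; ring
    · rw [dy_dilX hQ]; simp only [dilX, add_self_div_two]; ring
  have f1 := hX hu hv
  have f2 := hX hu2 hv2
  have eu : ∀ x, u (x, y₁) = Y' u (x, y₁) := fun x => by
    simp only [Y', dilY, add_self_div_two]; ring
  have ev : ∀ x, dx v (x, y₁) = dx (Y v) (x, y₁) := fun x => by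
    simp only [Y, dx_dilY hv]; simp only [dilY, add_self_div_two]; ring
  have f3 := setIntegral_dy_fluxY_eq (x₁ := x₁) (x₂ := x₂) (a := a) (b := b) hcd hy hu hv hu2 hv2
    eu ev
  have f4 := setIntegral_dy_fluxY_eq (x₁ := x₁) (x₂ := x₂) (a := a) (b := b) hcd hy hu1 hv1 hu3 hv3
    (fun x => by simp only [X, dilX, eu])
    (fun x => by simp only [X', dx_dilX hv, dx_dilX hv2]; simp only [dilX, ev])
  simp only [J, w, Λ, setIntegral_cut_mul_dy_mul_dx, hu, hv, hu1, hv1, hu2, hv2, hu3, hv3]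
  linarith

theorem setIntegral_cut_mul_dy_sq_eq (a b c d : ℝ) {u v : ℝ × ℝ → ℝ}
    (hu : ContDiff ℝ (⊤ : ℕ∞) u) {s : ℝ × ℝ → ℝ}
    (hs : Continuous s) {σ τ : ℝ} (h : ∀ q, dx v q = σ * dy u q + τ * s q) :
    ∫ q in box a b c d, cut x₁ x₂ y₁ y₂ q * (dy u q * dx v q)
      = σ * (∫ q in box a b c d, cut x₁ x₂ y₁ y₂ q * dy u q ^ 2)
        + τ * ∫ q in box a b c d, cut x₁ x₂ y₁ y₂ q * (dy u q * s q) := by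
  have := hu.dy.continuous
  have := continuous_cut x₁ x₂ y₁ y₂
  rw [← integral_const_mul, ← integral_const_mul, ← integral_add]
  · refine integral_congr_ae (Filter.Eventually.of_forall fun q => ?_)
    simp only [h]
    ring
  all_goals exact integrableOn_box (by fun_prop) a b c d

theorem setIntegral_cut_mul_dy_sq_le (hab : a < b) (hcd : c < d) (hx : AreEndpoints a b x₁ x₂)
    (hy : AreEndpoints c d y₁ y₂) {u v : ℝ × ℝ → ℝ} (hu : ContDiff ℝ (⊤ : ℕ∞) u)
    (hv : ContDiff ℝ (⊤ : ℕ∞) v) :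
    ∫ q in box a b c d, cut x₁ x₂ y₁ y₂ q * dy u q ^ 2
      ≤ 10 ^ 5 * (l2 (box a b c d) (dy u) * l2 (box a b c d) (fun q => dy u q + dx v q)
        + (l2 (box a b c d) (dx u) * l2 (box a b c d) (dy v)
          + 1 / (b - a) * (l2 (box a b c d) u * l2 (box a b c d) (dy v))
          + 1 / (b - a) / (d - c) * (l2 (box a b c d) u * l2 (box a b c d) v)
          + 1 / (d - c) * (l2 (box a b c d) (dx u) * l2 (box a b c d) v))) := by
  set R := box a b c d with hR
  set s : ℝ × ℝ → ℝ := fun q => dy u q + dx v q with hs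
  have cs : Continuous s := hu.dy.continuous.add hv.dx.continuous
  have hba : 0 < b - a := sub_pos.2 hab
  have hdc : 0 < d - c := sub_pos.2 hcd
  set u₂ := dilY y₁ (-2) 3 u with eu2
  set v₂ := dilY y₁ 4 (-3) v with ev2
  set s₂ := dilY y₁ 4 (-3) s with es2
  set u₁ := dilX x₁ 4 (-3) u with eu1
  set v₁ := dilX x₁ (-2) 3 v with ev1
  set s₁ := dilX x₁ 4 (-3) s with es1
  set u₃ := dilX x₁ 4 (-3) u₂ with eu3
  set v₃ := dilX x₁ (-2) 3 v₂ with ev3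
  set s₃ := dilX x₁ 4 (-3) s₂ with es3
  have hu2 : ContDiff ℝ (⊤ : ℕ∞) u₂ := hu.dilY _ _ _
  have hv2 : ContDiff ℝ (⊤ : ℕ∞) v₂ := hv.dilY _ _ _
  have hu1 : ContDiff ℝ (⊤ : ℕ∞) u₁ := hu.dilX _ _ _
  have hv1 : ContDiff ℝ (⊤ : ℕ∞) v₁ := hv.dilX _ _ _
  have hu3 : ContDiff ℝ (⊤ : ℕ∞) u₃ := hu2.dilX _ _ _
  have hv3 : ContDiff ℝ (⊤ : ℕ∞) v₃ := hv2.dilX _ _ _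
  have cs1 : Continuous s₁ := (contDiff_zero.2 cs).dilX _ _ _ |>.continuous
  have cs2 : Continuous s₂ := (contDiff_zero.2 cs).dilY _ _ _ |>.continuous
  have cs3 : Continuous s₃ := (contDiff_zero.2 cs2).dilX _ _ _ |>.continuous
  have bX : ∀ {f : ℝ × ℝ → ℝ} {α β : ℝ}, Continuous f → |α| + 2 * |β| ≤ 10 →
      l2 R (dilX x₁ α β f) ≤ 10 * l2 R f := fun hf h =>
    (l2_dilX_le hf (hx.mem hab) _ _).trans (mul_le_mul_of_nonneg_right h (l2_nonneg _ _))
  have bY : ∀ {f : ℝ × ℝ → ℝ} {α β : ℝ}, Continuous f → |α| + 2 * |β| ≤ 10 →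
      l2 R (dilY y₁ α β f) ≤ 10 * l2 R f := fun hf h =>
    (l2_dilY_le hf (hy.mem hcd) _ _).trans (mul_le_mul_of_nonneg_right h (l2_nonneg _ _))
  have low : ∀ {P Q : ℝ × ℝ → ℝ}, ContDiff ℝ (⊤ : ℕ∞) P → ContDiff ℝ (⊤ : ℕ∞) Q →
      l2 R P ≤ 100 * l2 R u → l2 R (dx P) ≤ 100 * l2 R (dx u) → l2 R Q ≤ 100 * l2 R v →
      l2 R (dy Q) ≤ 100 * l2 R (dy v) →
      |∫ q in R, lower x₁ x₂ y₁ y₂ P Q q| ≤ 10 ^ 4 * (l2 R (dx u) * l2 R (dy v)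
          + 1 / (b - a) * (l2 R u * l2 R (dy v))
          + 1 / (b - a) / (d - c) * (l2 R u * l2 R v)
          + 1 / (d - c) * (l2 R (dx u) * l2 R v)) := fun {P Q} hP hQ h1 h2 h3 h4 => by
    refine (abs_setIntegral_lower_le hab hcd hx hy hP hQ).trans ?_
    have m : ∀ {x y x' y' : ℝ}, 0 ≤ y → 0 ≤ x' → x ≤ 100 * x' → y ≤ 100 * y' →
        x * y ≤ 10 ^ 4 * (x' * y') := fun {x y x' y'} a1 a2 a3 a4 => by
      calc x * y ≤ (100 * x') * (100 * y') := mul_le_mul a3 a4 a1 (by positivity)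
        _ = _ := by ring
    have m1 := m (l2_nonneg _ _) (l2_nonneg _ _) h2 h4
    have m2 := mul_le_mul_of_nonneg_left (m (l2_nonneg _ _) (l2_nonneg _ _) h1 h4)
      (one_div_pos.2 hba).le
    have m3 := mul_le_mul_of_nonneg_left (m (l2_nonneg _ _) (l2_nonneg _ _) h1 h3)
      (div_pos (one_div_pos.2 hba) hdc).le
    have m4 := mul_le_mul_of_nonneg_left (m (l2_nonneg _ _) (l2_nonneg _ _) h2 h3)
      (one_div_pos.2 hdc).le
    linarith
  have strain : ∀ {P t : ℝ × ℝ → ℝ}, ContDiff ℝ (⊤ : ℕ∞) P → Continuous t →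
      l2 R (dy P) ≤ 100 * l2 R (dy u) → l2 R t ≤ 100 * l2 R s →
      |∫ q in R, cut x₁ x₂ y₁ y₂ q * (dy P q * t q)| ≤ 10 ^ 4 * (l2 R (dy u) * l2 R s) :=
    fun {P t} hP ht h1 h2 => by
      refine (abs_setIntegral_weight_mul_le hP.dy.continuous ht (continuous_cut _ _ _ _)
        (fun q hq => abs_cut_le hab hcd hx hy hq) zero_le_one).trans ?_
      calc 1 * (l2 R (dy P) * l2 R t) ≤ 1 * ((100 * l2 R (dy u)) * (100 * l2 R s)) := by
            have := l2_nonneg R (dy u)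
            have := l2_nonneg R t
            gcongr
        _ = _ := by ring
  have n0 : ∀ f, l2 R f ≤ 100 * l2 R f := fun f => by linarith [l2_nonneg R f]
  have L0 := abs_le.1 (low hu hv (n0 _) (n0 _) (n0 _) (n0 _))
  have a1 : |(4 : ℝ)| + 2 * |(-3 : ℝ)| ≤ 10 := by norm_num
  have a2 : |(-2 : ℝ)| + 2 * |(3 : ℝ)| ≤ 10 := by norm_num
  have a3 : |(4 : ℝ)| + 2 * |(-3 / 2 : ℝ)| ≤ 10 := by norm_num [abs_div]
  have a4 : |(-2 : ℝ)| + 2 * |(3 / 2 : ℝ)| ≤ 10 := by norm_num [abs_div]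
  have b1 := bX hu.continuous a1
  have b2 := bX hu.dx.continuous a3
  have b3 := bX hv.continuous a2
  have b4 := bX hv.dy.continuous a2
  have b5 := bX hu.dy.continuous a1
  have b6 := bX cs a1
  rw [← dx_dilX hu] at b2
  rw [← dy_dilX hv] at b4
  rw [← dy_dilX hu] at b5
  have c1 := bY hu.continuous a2
  have c2 := bY hu.dx.continuous a2
  have c3 := bY hv.continuous a1
  have c4 := bY hv.dy.continuous a3
  have c5 := bY hu.dy.continuous a4
  have c6 := bY cs a1
  rw [← dx_dilY hu] at c2
  rw [← dy_dilY hv] at c4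
  rw [← dy_dilY hu] at c5
  have d1 := bX hu2.continuous a1
  have d2 := bX hu2.dx.continuous a3
  have d3 := bX hv2.continuous a2
  have d4 := bX hv2.dy.continuous a2
  have d5 := bX hu2.dy.continuous a1
  have d6 := bX cs2 a1
  rw [← dx_dilX hu2] at d2
  rw [← dy_dilX hv2] at d4
  rw [← dy_dilX hu2] at d5
  have two : ∀ {x y z : ℝ}, x ≤ 10 * y → y ≤ 10 * z → x ≤ 100 * z := fun h h' => by linarith
  have wk : ∀ {x : ℝ} (f : ℝ × ℝ → ℝ), x ≤ 10 * l2 R f → x ≤ 100 * l2 R f := fun f h => by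
    linarith [l2_nonneg R f]
  have L1 := abs_le.1 (low hu1 hv1 (wk _ b1) (wk _ b2) (wk _ b3) (wk _ b4))
  have L2 := abs_le.1 (low hu2 hv2 (wk _ c1) (wk _ c2) (wk _ c3) (wk _ c4))
  have L3 := abs_le.1 (low hu3 hv3 (two d1 c1) (two d2 c2) (two d3 c3) (two d4 c4))
  have S0 := abs_le.1 (strain hu cs (n0 _) (n0 _))
  have S1 := abs_le.1 (strain hu1 cs1 (wk _ b5) (wk _ b6))
  have S2 := abs_le.1 (strain hu2 cs2 (wk _ c5) (wk _ c6))
  have S3 := abs_le.1 (strain hu3 cs3 (two d5 c5) (two d6 c6))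
  have pos : ∀ P : ℝ × ℝ → ℝ, 0 ≤ ∫ q in R, cut x₁ x₂ y₁ y₂ q * dy P q ^ 2 := fun P =>
    setIntegral_nonneg (measurableSet_box a b c d) fun q hq =>
      mul_nonneg (cut_nonneg hab hcd hx hy hq) (sq_nonneg _)
  have E := setIntegral_cut_mul_reflections hab hcd hx hy hu hv
  simp only [← eu1, ← ev1, ← eu2, ← ev2, ← eu3, ← ev3] at E
  have E0 := setIntegral_cut_mul_dy_sq_eq (x₁ := x₁) (x₂ := x₂) (y₁ := y₁) (y₂ := y₂)
    (v := v) a b c d hu cs (σ := -1) (τ := 1) fun q => by simp only [hs]; ring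
  have E1 := setIntegral_cut_mul_dy_sq_eq (x₁ := x₁) (x₂ := x₂) (y₁ := y₁) (y₂ := y₂)
    (v := v₁) a b c d hu1 cs1 (σ := 1 / 2) (τ := -1 / 2) fun q => by
      simp only [eu1, ev1, es1, dx_dilX hv, dy_dilX hu, hs]; simp only [dilX]; ring
  have E2 := setIntegral_cut_mul_dy_sq_eq (x₁ := x₁) (x₂ := x₂) (y₁ := y₁) (y₂ := y₂)
    (v := v₂) a b c d hu2 cs2 (σ := 2) (τ := 1) fun q => by
      simp only [eu2, ev2, es2, dx_dilY hv, dy_dilY hu, hs]; simp only [dilY]; ring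
  have E3 := setIntegral_cut_mul_dy_sq_eq (x₁ := x₁) (x₂ := x₂) (y₁ := y₁) (y₂ := y₂)
    (v := v₃) a b c d hu3 cs3 (σ := -1) (τ := -1 / 2) fun q => by
      simp only [eu3, ev3, es3, dx_dilX hv2, dy_dilX hu2]
      simp only [eu2, ev2, es2, dx_dilY hv, dy_dilY hu, hs]
      simp only [dilX, dilY]; ring
  rw [E0, E1, E2, E3] at E
  have p1 := pos u₁
  have p2 := pos u₂
  have p3 := pos u₃
  have q0 : 0 ≤ l2 R (dy u) * l2 R s := mul_nonneg (l2_nonneg _ _) (l2_nonneg _ _)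
  linarith

end Corner

theorem l2_dy_sq_le {a b c d : ℝ} (hab : a < b) (hcd : c < d) {u v : ℝ × ℝ → ℝ}
    (hu : ContDiff ℝ (⊤ : ℕ∞) u) (hv : ContDiff ℝ (⊤ : ℕ∞) v) :
    l2 (box a b c d) (dy u) ^ 2
      ≤ 4 * 10 ^ 5 * (l2 (box a b c d) (dy u) * l2 (box a b c d) (fun q => dy u q + dx v q)
        + (l2 (box a b c d) (dx u) * l2 (box a b c d) (dy v)
          + 1 / (b - a) * (l2 (box a b c d) u * l2 (box a b c d) (dy v))
          + 1 / (b - a) / (d - c) * (l2 (box a b c d) u * l2 (box a b c d) v)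
          + 1 / (d - c) * (l2 (box a b c d) (dx u) * l2 (box a b c d) v))) := by
  have hba : b - a ≠ 0 := (sub_pos.2 hab).ne'
  have hdc : d - c ≠ 0 := (sub_pos.2 hcd).ne'
  have := hu.dy.continuous
  have hc := continuous_cut
  have x1 : AreEndpoints a b a b := Or.inl ⟨rfl, rfl⟩
  have x2 : AreEndpoints a b b a := Or.inr ⟨rfl, rfl⟩
  have y1 : AreEndpoints c d c d := Or.inl ⟨rfl, rfl⟩
  have y2 : AreEndpoints c d d c := Or.inr ⟨rfl, rfl⟩
  have e : ∫ q in box a b c d, dy u q ^ 2 =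
      (∫ q in box a b c d, cut a b c d q * dy u q ^ 2)
      + (∫ q in box a b c d, cut b a c d q * dy u q ^ 2)
      + (∫ q in box a b c d, cut a b d c q * dy u q ^ 2)
      + ∫ q in box a b c d, cut b a d c q * dy u q ^ 2 := by
    rw [← integral_add, ← integral_add, ← integral_add]
    · refine integral_congr_ae (Filter.Eventually.of_forall fun q => ?_)
      have sx : (b - q.1) / (b - a) + (a - q.1) / (a - b) = 1 := by
        rw [← neg_sub b a, div_neg, ← sub_eq_add_neg, ← sub_div, div_eq_one_iff_eq hba]; ring
      have sy : (d - q.2) / (d - c) + (c - q.2) / (c - d) = 1 := by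
        rw [← neg_sub d c, div_neg, ← sub_eq_add_neg, ← sub_div, div_eq_one_iff_eq hdc]; ring
      have h1 : cut a b c d q + cut b a c d q + cut a b d c q + cut b a d c q = 1 := by
        calc _ = ((b - q.1) / (b - a) + (a - q.1) / (a - b))
              * ((d - q.2) / (d - c) + (c - q.2) / (c - d)) := by unfold cut; ring
          _ = 1 := by rw [sx, sy, one_mul]
      calc dy u q ^ 2 = (cut a b c d q + cut b a c d q + cut a b d c q + cut b a d c q)
            * dy u q ^ 2 := by rw [h1, one_mul]
        _ = _ := by ring
    all_goals exact integrableOn_box (by fun_prop) a b c d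
  rw [l2_sq, e]
  linarith [setIntegral_cut_mul_dy_sq_le hab hcd x1 y1 hu hv,
    setIntegral_cut_mul_dy_sq_le hab hcd x2 y1 hu hv,
    setIntegral_cut_mul_dy_sq_le hab hcd x1 y2 hu hv,
    setIntegral_cut_mul_dy_sq_le hab hcd x2 y2 hu hv]

/-- First-and-a-half Korn inequality (Theorem 2.4). -/
theorem first_and_a_half_korn :
    ∀ L : ℝ, 0 < L → ∃ C₀ : ℝ, 0 < C₀ ∧ ∀ h : ℝ, 0 < h → h < 1 →
      ∀ u v : ℝ × ℝ → ℝ, ContDiff ℝ (⊤ : ℕ∞) u → ContDiff ℝ (⊤ : ℕ∞) v →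
      (∀ x ∈ Ih h, v (x, 0) = 0) →
      (∫ q in rect h L, ((dx u q)^2 + (dy u q)^2 + (dx v q)^2 + (dy v q)^2))
        ≤ C₀ * Real.sqrt (∫ q in rect h L,
              ((dx u q)^2 + 2*((dy u q + dx v q)/2)^2 + (dy v q)^2)) *
            (Real.sqrt (∫ q in rect h L, (u q)^2) / h
              + Real.sqrt (∫ q in rect h L,
                  ((dx u q)^2 + 2*((dy u q + dx v q)/2)^2 + (dy v q)^2))) := by
  intro L hL
  refine ⟨10 ^ 15, by positivity, fun h hh _ u v hu hv hbc => ?_⟩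
  have hR : rect h L = box (1 - h / 2) (1 + h / 2) 0 L := rfl
  have hw : 1 + h / 2 - (1 - h / 2) = h := by ring
  have main := l2_dy_sq_le (a := 1 - h / 2) (b := 1 + h / 2) (c := 0) (d := L)
    (by linarith) hL hu hv
  have hV := l2_le_of_eq_zero_bottom hv hL.le hbc
  rw [hw, sub_zero] at main
  have cux := hu.dx.continuous
  have cuy := hu.dy.continuous
  have cvx := hv.dx.continuous
  have cvy := hv.dy.continuous
  have eG : ∫ q in rect h L, ((dx u q)^2 + (dy u q)^2 + (dx v q)^2 + (dy v q)^2)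
      = l2 (rect h L) (dx u) ^ 2 + l2 (rect h L) (dy u) ^ 2 + l2 (rect h L) (dx v) ^ 2
        + l2 (rect h L) (dy v) ^ 2 := by
    simp only [l2_sq]
    rw [← integral_add, ← integral_add, ← integral_add]
    all_goals exact integrableOn_box (by fun_prop) _ _ _ _
  have eE : l2 (rect h L) (dx u) ^ 2 + 1 / 2 * l2 (rect h L) (fun q => dy u q + dx v q) ^ 2
        + l2 (rect h L) (dy v) ^ 2
      = √(∫ q in rect h L, ((dx u q)^2 + 2*((dy u q + dx v q)/2)^2 + (dy v q)^2)) ^ 2 := by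
    rw [Real.sq_sqrt (integral_nonneg fun q => by positivity)]
    simp only [l2_sq]
    rw [← integral_const_mul, ← integral_add, ← integral_add]
    · refine integral_congr_ae (Filter.Eventually.of_forall fun q => ?_)
      simp only []
      ring
    all_goals exact integrableOn_box (by fun_prop) _ _ _ _
  have hS : l2 (rect h L) (dx v)
      ≤ l2 (rect h L) (fun q => dy u q + dx v q) + l2 (rect h L) (dy u) := by
    have := l2_add_le (f := fun q => dy u q + dx v q) (g := fun q => (-1) * dy u q)
      (cuy.add cvx) (by fun_prop) (1 - h / 2) (1 + h / 2) 0 L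
    rw [l2_const_mul, abs_neg, abs_one, one_mul, ← hR] at this
    convert this using 2
    ext q
    ring
  rw [← hR] at main hV
  rw [eG]
  change _ ≤ _ * _ * (l2 (rect h L) u / h + _)
  set E := √(∫ q in rect h L, ((dx u q)^2 + 2*((dy u q + dx v q)/2)^2 + (dy v q)^2))
  have hE : 0 ≤ E := Real.sqrt_nonneg _
  have n1 := l2_nonneg (rect h L) (dx u)
  have n2 := l2_nonneg (rect h L) (dy u)
  have n3 := l2_nonneg (rect h L) (dx v)
  have n4 := l2_nonneg (rect h L) (dy v)
  have n5 := l2_nonneg (rect h L) u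
  have n6 := l2_nonneg (rect h L) v
  have n7 := l2_nonneg (rect h L) (fun q => dy u q + dx v q)
  generalize l2 (rect h L) (fun q => dy u q + dx v q) = S at *
  generalize l2 (rect h L) (dx u) = A at *
  generalize l2 (rect h L) (dy u) = G at *
  generalize l2 (rect h L) (dx v) = W at *
  generalize l2 (rect h L) (dy v) = B at *
  generalize l2 (rect h L) u = N at *
  generalize l2 (rect h L) v = V at *
  clear_value E
  have hA : A ≤ E := by nlinarith
  have hB : B ≤ E := by nlinarith
  have hS2 : S ≤ 2 * E := by nlinarith
  have hVL : V / L ≤ 2 * E := by rw [div_le_iff₀ hL]; nlinarith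
  have hNh : 0 ≤ N / h := by positivity
  have r1 : 1 / h * (N * B) ≤ N / h * E := by
    calc 1 / h * (N * B) = N / h * B := by ring
      _ ≤ _ := by gcongr
  have r2 : 1 / h / L * (N * V) ≤ N / h * (2 * E) := by
    calc 1 / h / L * (N * V) = N / h * (V / L) := by ring
      _ ≤ _ := by gcongr
  have r3 : 1 / L * (A * V) ≤ E * (2 * E) := by
    calc 1 / L * (A * V) = A * (V / L) := by ring
      _ ≤ _ := by gcongr
  have r4 : A * B ≤ E * E := by gcongr
  have r5 : G * S ≤ G * (2 * E) := by gcongr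
  generalize N / h = T at *
  have hG : G ^ 2 ≤ 4 * 10 ^ 5 * (2 * (G * E) + 3 * (E * E) + 3 * (T * E)) := by linarith
  have hG2 : G ^ 2 ≤ 10 ^ 13 * (E * E + T * E) := by
    nlinarith [sq_nonneg (G - 16 * 10 ^ 5 * E), mul_nonneg hNh hE]
  have hW : W ^ 2 ≤ 8 * (E * E) + 2 * G ^ 2 := by nlinarith [sq_nonneg (2 * E - G)]
  nlinarith [mul_nonneg hNh hE, mul_nonneg hE hE, sq_nonneg S]
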